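/- Scale-stretching for replicated systems: Let X be a system with nested partition sequence P, and let m*X consist of m identical copies of X (each copy determined by any other, via bijections f_i with H(x|f_i(x)) = H(f_i(x)|x) = 0). Then with the nested partition sequence m*P defined in context, C_{m*X}^{m*P}(n) = C_X^P(⌈n/m⌉) for all n ≥ 1. -/

import Mathlib

open scoped BigOperators Classical

namespace Ashby

/-- A probability mass function on a finite sample space. -/
def IsProb {Ω : Type*} [Fintype Ω] (μ : Ω → ℝ) : Prop :=
  (∀ ω, 0 ≤ μ ω) ∧ ∑ ω, μ ω = 1

/-- Probability that the random variable `X` takes the value `a`. -/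
noncomputable def prob {Ω α : Type*} [Fintype Ω] (μ : Ω → ℝ) (X : Ω → α) (a : α) : ℝ :=
  ∑ ω, if X ω = a then μ ω else 0

/-- Shannon entropy of a discrete random variable. -/
noncomputable def H {Ω α : Type*} [Fintype Ω] [Fintype α] (μ : Ω → ℝ) (X : Ω → α) : ℝ :=
  ∑ a, Real.negMulLog (prob μ X a)

/-- Conditional entropy `H(Y|X)`. -/
noncomputable def condH {Ω α β : Type*} [Fintype Ω] [Fintype α] [Fintype β]
    (μ : Ω → ℝ) (Y : Ω → β) (X : Ω → α) : ℝ :=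
  H μ (fun ω => (X ω, Y ω)) - H μ X

/-- Mutual information `I(X;Y)`. -/
noncomputable def mutualInfo {Ω α β : Type*} [Fintype Ω] [Fintype α] [Fintype β]
    (μ : Ω → ℝ) (X : Ω → α) (Y : Ω → β) : ℝ :=
  H μ X + H μ Y - H μ (fun ω => (X ω, Y ω))

/-- Conditional mutual information `I(X;Y|Z)`. -/
noncomputable def condMutualInfo {Ω α β γ : Type*} [Fintype Ω] [Fintype α] [Fintype β] [Fintype γ]
    (μ : Ω → ℝ) (X : Ω → α) (Y : Ω → β) (Z : Ω → γ) : ℝ :=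
  condH μ X Z + condH μ Y Z - condH μ (fun ω => (X ω, Y ω)) Z

/-- Entropy of the joint random variable formed by the components of the system `x`
whose indices lie in the part `S`. -/
noncomputable def Hset {Ω α ι : Type*} [Fintype Ω] [Fintype α] [DecidableEq ι]
    (μ : Ω → ℝ) (x : ι → Ω → α) (S : Finset ι) : ℝ :=
  H μ (fun ω => (fun i : S => x i.1 ω))

/-- A nested partition sequence of the (index set of a) system: for each `n ≥ 1`,
`part n` is a partition of the index set, `part n` refines `part m` whenever `n ≥ m ≥ 1`,
and this refinement is strict whenever `|X| ≥ n > m ≥ 1`. -/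
structure NPS (ι : Type*) [Fintype ι] [DecidableEq ι] where
  part : ℕ → Finset (Finset ι)
  partition : ∀ n, 1 ≤ n → (∅ ∉ part n ∧ ∀ i : ι, ∃! χ, χ ∈ part n ∧ i ∈ χ)
  refines : ∀ m n, 1 ≤ m → m ≤ n → ∀ χ ∈ part n, ∃ χ' ∈ part m, χ ⊆ χ'
  strict : ∀ m n, 1 ≤ m → m < n → n ≤ Fintype.card ι → part n ≠ part m

/-- `S̃_X^P(n) = Σ_{χ ∈ P_n} H(χ)`, with `S̃_X^P(0) = 0`. -/
noncomputable def Stilde {Ω α ι : Type*} [Fintype Ω] [Fintype α] [Fintype ι] [DecidableEq ι]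
    (μ : Ω → ℝ) (x : ι → Ω → α) (P : NPS ι) (n : ℕ) : ℝ :=
  if n = 0 then 0 else ∑ χ ∈ P.part n, Hset μ x χ

/-- The complexity profile `C_X^P(n) = S̃_X^P(n) − S̃_X^P(n−1)`. -/
noncomputable def C {Ω α ι : Type*} [Fintype Ω] [Fintype α] [Fintype ι] [DecidableEq ι]
    (μ : Ω → ℝ) (x : ι → Ω → α) (P : NPS ι) (n : ℕ) : ℝ :=
  Stilde μ x P n - Stilde μ x P (n - 1)

section Entropy

variable {Ω α β : Type*} [Fintype Ω] [Fintype α] [Fintype β] {μ : Ω → ℝ}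

/-- Entropy as the expected self-information of the observed value. -/
lemma H_eq_sum_sample (μ : Ω → ℝ) (X : Ω → α) :
    H μ X = ∑ ω, μ ω * -Real.log (prob μ X (X ω)) := by
  unfold H Real.negMulLog
  have h : ∀ a, -prob μ X a * Real.log (prob μ X a)
      = ∑ ω, if X ω = a then μ ω * -Real.log (prob μ X a) else 0 := by
    intro a
    conv_lhs => rw [neg_mul, ← mul_neg]
    nth_rewrite 1 [prob]
    rw [Finset.sum_mul]
    exact Finset.sum_congr rfl fun ω _ => by split_ifs <;> simp
  rw [Finset.sum_congr rfl fun a _ => h a, Finset.sum_comm]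
  simp

lemma prob_self_pos {Ω α : Type*} [Fintype Ω] {μ : Ω → ℝ} (hμ : ∀ ω, 0 ≤ μ ω)
    (X : Ω → α) {ω : Ω} (hω : μ ω ≠ 0) :
    0 < prob μ X (X ω) := by
  unfold prob
  refine Finset.sum_pos' (fun ω' _ => ?_) ⟨ω, Finset.mem_univ _, ?_⟩
  · split_ifs
    exacts [hμ _, le_rfl]
  · simpa using lt_of_le_of_ne (hμ ω) hω.symm

/-- Variables that induce the same partition of the support have the same entropy. -/
lemma H_eq_of_support_iff {X : Ω → α} {Y : Ω → β}
    (h : ∀ ω ω', μ ω ≠ 0 → μ ω' ≠ 0 → (X ω' = X ω ↔ Y ω' = Y ω)) : H μ X = H μ Y := by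
  rw [H_eq_sum_sample, H_eq_sum_sample]
  refine Finset.sum_congr rfl fun ω _ => ?_
  by_cases hω : μ ω = 0
  · simp [hω]
  · have : prob μ X (X ω) = prob μ Y (Y ω) := by
      unfold prob
      refine Finset.sum_congr rfl fun ω' _ => ?_
      by_cases hω' : μ ω' = 0
      · simp [hω']
      · simp only [h ω ω' hω hω']
    rw [this]

lemma prob_pair_le {Ω α β : Type*} [Fintype Ω] {μ : Ω → ℝ} (hμ : ∀ ω, 0 ≤ μ ω)
    (X : Ω → α) (Y : Ω → β) (a : α) (b : β) :
    prob μ (fun ω => (X ω, Y ω)) (a, b) ≤ prob μ X a := by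
  unfold prob
  refine Finset.sum_le_sum fun ω _ => ?_
  have := hμ ω
  by_cases h : X ω = a <;> by_cases h' : Y ω = b <;> simp [h, h', this]

/-- If `H(Y|X) = 0` then `X` determines `Y` on the support. -/
lemma eq_of_condH_eq_zero (hμ : ∀ ω, 0 ≤ μ ω) {X : Ω → α} {Y : Ω → β}
    (h : condH μ Y X = 0) {ω ω' : Ω} (hω : μ ω ≠ 0) (hω' : μ ω' ≠ 0) (hX : X ω' = X ω) :
    Y ω' = Y ω := by
  have hpos := fun ω (hω : μ ω ≠ 0) => prob_self_pos hμ (fun ω => (X ω, Y ω)) hω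
  rw [condH, H_eq_sum_sample, H_eq_sum_sample, ← Finset.sum_sub_distrib,
    Finset.sum_eq_zero_iff_of_nonneg] at h
  · have h0 := h ω (Finset.mem_univ _)
    rw [← mul_sub, mul_eq_zero, or_iff_right hω] at h0
    have heq : prob μ X (X ω) = prob μ (fun ω => (X ω, Y ω)) (X ω, Y ω) :=
      Real.log_injOn_pos (prob_self_pos hμ X hω) (hpos ω hω) (by linarith)
    by_contra hY
    refine absurd heq (ne_of_gt ?_)
    unfold prob
    refine Finset.sum_lt_sum (fun ω'' _ => ?_) ⟨ω', Finset.mem_univ _, ?_⟩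
    · have := hμ ω''
      by_cases h1 : X ω'' = X ω <;> by_cases h2 : Y ω'' = Y ω <;> simp [h1, h2, this]
    · simpa [hX, hY] using lt_of_le_of_ne (hμ ω') hω'.symm
  · intro ω _
    rw [← mul_sub]
    by_cases hω : μ ω = 0
    · simp [hω]
    · have := Real.log_le_log (hpos ω hω) (prob_pair_le hμ X Y (X ω) (Y ω))
      exact mul_nonneg (hμ ω) (by linarith)

lemma Hset_empty {ι : Type*} [DecidableEq ι] (hμ : IsProb μ) (x : ι → Ω → α) :
    Hset μ x ∅ = 0 := by
  rw [Hset, H_eq_sum_sample]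
  refine Finset.sum_eq_zero fun ω _ => ?_
  have : prob μ (fun ω => fun i : (∅ : Finset ι) => x i.1 ω) (fun i => x i.1 ω) = 1 := by
    rw [← hμ.2]
    exact Finset.sum_congr rfl fun ω' _ => if_pos (Subsingleton.elim _ _)
  simp [this]

/-- A set of copied components has the entropy of the set of original components. -/
lemma Hset_copy {ι κ : Type*} [DecidableEq ι] [DecidableEq κ] (hμ : ∀ ω, 0 ≤ μ ω)
    {x : ι → Ω → α} {y : ι × κ → Ω → α}
    (hcopy : ∀ i j, condH μ (y (i, j)) (x i) = 0 ∧ condH μ (x i) (y (i, j)) = 0)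
    (S : Finset (ι × κ)) : Hset μ y S = Hset μ x (S.image Prod.fst) := by
  refine H_eq_of_support_iff fun ω ω' hω hω' => ?_
  simp only [funext_iff, Subtype.forall, Finset.mem_image]
  constructor
  · rintro h _ ⟨⟨i, j⟩, hp, rfl⟩
    exact eq_of_condH_eq_zero hμ (hcopy i j).2 hω hω' (h _ hp)
  · rintro h ⟨i, j⟩ hp
    exact eq_of_condH_eq_zero hμ (hcopy i j).1 hω hω' (h i ⟨_, hp, rfl⟩)

end Entropy

section Replication

/-- The stage reached by the copy with index `j` at stage `n` of the replicated sequence. -/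
lemma stage_eq_div {m j : ℕ} (hj : j < m) (n : ℕ) :
    (if j < n % m then (n + m - 1) / m else n / m) = (n + (m - 1 - j)) / m := by
  have hm : 0 < m := by omega
  obtain ⟨q, r, hr, rfl⟩ : ∃ q r, r < m ∧ n = r + m * q :=
    ⟨n / m, n % m, Nat.mod_lt _ hm, (Nat.mod_add_div n m).symm⟩
  rw [Nat.add_mul_mod_self_left, Nat.mod_eq_of_lt hr, Nat.add_mul_div_left _ _ hm,
    Nat.div_eq_of_lt hr, show r + m * q + m - 1 = (r + m - 1) + m * q by omega,
    show r + m * q + (m - 1 - j) = (r + (m - 1 - j)) + m * q by omega,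
    Nat.add_mul_div_left _ _ hm, Nat.add_mul_div_left _ _ hm]
  split_ifs with h
  · rw [Nat.div_eq_of_lt_le (k := 1) (by omega) (by omega),
      Nat.div_eq_of_lt_le (k := 1) (by omega) (by omega)]
  · rw [Nat.div_eq_of_lt (by omega : r + (m - 1 - j) < m)]

/-- Advancing the replicated sequence by one stage advances exactly one copy. -/
lemma sum_stage_succ_sub (f : ℕ → ℝ) {m : ℕ} (hm : 0 < m) (k : ℕ) :
    ∑ j : Fin m, f ((k + 1 + (m - 1 - j)) / m) - ∑ j : Fin m, f ((k + (m - 1 - j)) / m)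
      = f (k / m + 1) - f (k / m) := by
  rw [← Finset.sum_sub_distrib, Finset.sum_eq_single ⟨k % m, Nat.mod_lt _ hm⟩]
  · have hr := Nat.mod_lt k hm
    have hk := Nat.mod_add_div k m
    congr 2
    · rw [show k + 1 + (m - 1 - k % m) = m * (k / m) + m by omega, Nat.add_div_right _ hm,
        Nat.mul_div_cancel_left _ hm]
    · rw [show k + (m - 1 - k % m) = (m - 1) + m * (k / m) by omega,
        Nat.add_mul_div_left _ _ hm, Nat.div_eq_of_lt (by omega), zero_add]
  · intro j _ hj
    have hj' : (j : ℕ) ≠ k % m := fun h => hj (Fin.ext h)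
    have hr := Nat.mod_lt k hm
    have hk := Nat.mod_add_div k m
    have hjm := j.2
    rw [sub_eq_zero]
    congr 1
    rcases lt_or_gt_of_ne hj' with h | h
    · rw [show k + 1 + (m - 1 - j) = (k % m - j) + m * (k / m + 1) by rw [mul_add]; omega,
        show k + (m - 1 - j) = (k % m - j - 1) + m * (k / m + 1) by rw [mul_add]; omega,
        Nat.add_mul_div_left _ _ hm, Nat.add_mul_div_left _ _ hm,
        Nat.div_eq_of_lt (by omega : k % m - j < m),
        Nat.div_eq_of_lt (by omega : k % m - j - 1 < m)]
    · rw [show k + 1 + (m - 1 - j) = (k % m + m - j) + m * (k / m) by omega,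
        show k + (m - 1 - j) = (k % m + m - 1 - j) + m * (k / m) by omega,
        Nat.add_mul_div_left _ _ hm, Nat.add_mul_div_left _ _ hm,
        Nat.div_eq_of_lt (by omega : k % m + m - j < m),
        Nat.div_eq_of_lt (by omega : k % m + m - 1 - j < m)]
  · simp

/-- A family of pairwise disjoint parts, each inside one copy: summing a function of the
projected parts splits into the sums over the families induced on the copies. -/
lemma sum_image_fst_eq_sum_slices {ι κ : Type*} [DecidableEq ι] [Fintype κ] [DecidableEq κ]
    {F : Finset (Finset (ι × κ))} {f : Finset ι → ℝ} (hf : f ∅ = 0)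
    (hdisj : ∀ χ ∈ F, ∀ χ' ∈ F, ∀ p ∈ χ, p ∈ χ' → χ = χ')
    (hslice : ∀ χ ∈ F, ∃ j, ∀ p ∈ χ, p.2 = j) :
    ∑ χ ∈ F, f (χ.image Prod.fst)
      = ∑ j, ∑ ψ ∈ (F.image fun χ => (χ.filter fun p => p.2 = j).image Prod.fst) \ {∅},
          f ψ := by
  have h : ∀ j, ∑ ψ ∈ (F.image fun χ => (χ.filter fun p => p.2 = j).image Prod.fst) \ {∅}, f ψ
      = ∑ χ ∈ F, f ((χ.filter fun p => p.2 = j).image Prod.fst) := by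
    intro j
    rw [Finset.sum_subset Finset.sdiff_subset]
    · refine Finset.sum_image_of_pairwise_eq_zero ?_
      intro χ hχ χ' hχ' hne heq
      by_contra h0
      have hne0 : ((χ.filter fun p => p.2 = j).image Prod.fst).Nonempty := by
        rw [Finset.nonempty_iff_ne_empty]
        intro h
        exact h0 (by simp only [h, hf])
      obtain ⟨i, hi⟩ := hne0
      have hi' := hi
      simp only [heq] at hi'
      simp only [Finset.mem_image, Finset.mem_filter, Prod.exists, exists_and_right,
        exists_eq_right] at hi hi'
      exact hne (hdisj χ hχ χ' hχ' _ hi hi')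
    · intro ψ hψ hψ'
      simp only [Finset.mem_sdiff, hψ, Finset.mem_singleton, true_and, not_not] at hψ'
      rw [hψ', hf]
  rw [Finset.sum_congr rfl fun j _ => h j, Finset.sum_comm]
  refine Finset.sum_congr rfl fun χ hχ => ?_
  obtain ⟨j, hj⟩ := hslice χ hχ
  rw [Finset.sum_eq_single j, Finset.filter_true_of_mem hj]
  · intro j' _ hne
    rw [Finset.filter_false_of_mem fun p hp hp' => hne (hp'.symm.trans (hj p hp)),
      Finset.image_empty, hf]
  · simp

end Replication

/-- Scale-stretching for replicated systems: the system `xm` consists of `m` identical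
copies of `x` (each component of each copy determines and is determined by the
corresponding original component), and `Q = m*P` is the nested partition sequence of the
replicated system built from `P` as in the paper.  Then
`C_{m*X}^{m*P}(n) = C_X^P(⌈n/m⌉)` for all `n ≥ 1`. -/
theorem replicated_scale_stretch {Ω α ι : Type*} [Fintype Ω] [Fintype α]
    [Fintype ι] [DecidableEq ι]
    (μ : Ω → ℝ) (hμ : IsProb μ) (m : ℕ) (hm : 1 ≤ m)
    (x : ι → Ω → α) (xm : ι × Fin m → Ω → α)
    (hcopy : ∀ (i : ι) (j : Fin m),
      condH μ (xm (i, j)) (x i) = 0 ∧ condH μ (x i) (xm (i, j)) = 0)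
    (P : NPS ι) (Q : NPS (ι × Fin m))
    (hQsmall : ∀ n, 1 ≤ n → n ≤ m →
      Q.part n =
        ((Finset.univ.filter (fun j : Fin m => (j : ℕ) < n - 1)).image
            (fun j => Finset.univ.filter (fun p : ι × Fin m => p.2 = j))) ∪
          {Finset.univ.filter (fun p : ι × Fin m => n - 1 ≤ (p.2 : ℕ))})
    (hQlarge : ∀ n, m ≤ n → ∀ j : Fin m,
      ((Q.part n).image (fun χ => (χ.filter (fun p => p.2 = j)).image Prod.fst)) \ {∅}
        = P.part (if (j : ℕ) < n % m then (n + m - 1) / m else n / m)) :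
    ∀ n, 1 ≤ n → C μ xm Q n = C μ x P ((n + m - 1) / m) := by
  have hH := Hset_copy hμ.1 hcopy
  have hι : Nonempty ι := by
    by_contra hne
    rw [not_nonempty_iff] at hne
    refine (Q.partition 1 le_rfl).1 ?_
    rw [hQsmall 1 le_rfl hm, Finset.mem_union, Finset.mem_singleton]
    exact Or.inr (Subsingleton.elim _ _)
  have hfst : ∀ (p : Fin m → Prop) [DecidablePred p] (j : Fin m), p j →
      (Finset.univ.filter fun q : ι × Fin m => p q.2).image Prod.fst = Finset.univ := by
    intro p _ j hj
    ext i
    simpa using ⟨j, hj⟩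
  have hslice : ∀ n, m ≤ n → ∀ χ ∈ Q.part n, ∃ j, ∀ p ∈ χ, p.2 = j := by
    intro n hn χ hχ
    obtain ⟨χ', hχ', hsub⟩ := Q.refines m n hm hn χ hχ
    rw [hQsmall m hm le_rfl, Finset.mem_union, Finset.mem_image, Finset.mem_singleton] at hχ'
    rcases hχ' with ⟨j, -, rfl⟩ | rfl
    · exact ⟨j, fun p hp => by simpa using hsub hp⟩
    · refine ⟨⟨m - 1, by omega⟩, fun p hp => ?_⟩
      have h1 : m - 1 ≤ (p.2 : ℕ) := by simpa using hsub hp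
      have h2 := p.2.2
      exact Fin.ext (by simp only; omega)
  have hlarge : ∀ n, m ≤ n →
      Stilde μ xm Q n = ∑ j : Fin m, Stilde μ x P ((n + (m - 1 - j)) / m) := by
    intro n hn
    rw [Stilde, if_neg (by omega), Finset.sum_congr rfl fun χ _ => hH χ,
      sum_image_fst_eq_sum_slices (Hset_empty hμ x) _ (hslice n hn)]
    · refine Finset.sum_congr rfl fun j _ => ?_
      have hpos : (n + (m - 1 - j)) / m ≠ 0 :=
        (Nat.div_pos (by omega) (by omega)).ne'
      rw [hQlarge n hn j, stage_eq_div j.2, Stilde, if_neg hpos]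
    · intro χ hχ χ' hχ' p hp hp'
      exact ((Q.partition n (by omega)).2 p).unique ⟨hχ, hp⟩ ⟨hχ', hp'⟩
  have hP1 : Stilde μ x P 1 = Hset μ x Finset.univ := by
    have hpart := hQlarge m le_rfl ⟨0, hm⟩
    have hu : Finset.univ ∈ P.part 1 := by
      rw [Nat.mod_self, if_neg (by simp), Nat.div_self hm] at hpart
      rw [← hpart, Finset.mem_sdiff, Finset.mem_singleton]
      refine ⟨Finset.mem_image.2 ?_, Finset.univ_nonempty.ne_empty⟩
      obtain ⟨i⟩ := hι
      obtain ⟨χ, ⟨hχ, hmem⟩, -⟩ := (Q.partition m hm).2 (i, ⟨0, hm⟩)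
      refine ⟨χ, hχ, ?_⟩
      have hχ' := hχ
      rw [hQsmall m hm le_rfl, Finset.mem_union, Finset.mem_image, Finset.mem_singleton] at hχ'
      rcases hχ' with ⟨j, -, rfl⟩ | rfl
      · rw [Finset.mem_filter] at hmem
        rw [Finset.filter_filter]
        exact hfst (fun k => k = j ∧ k = ⟨0, hm⟩) ⟨0, hm⟩ ⟨hmem.2, rfl⟩
      · rw [Finset.mem_filter] at hmem
        rw [Finset.filter_filter]
        exact hfst (fun k => m - 1 ≤ (k : ℕ) ∧ k = ⟨0, hm⟩) ⟨0, hm⟩ ⟨hmem.2, rfl⟩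
    have hsingle : P.part 1 = {Finset.univ} := by
      refine Finset.eq_singleton_iff_unique_mem.2 ⟨hu, fun ψ hψ => ?_⟩
      have hne : ψ.Nonempty := Finset.nonempty_iff_ne_empty.2 fun h =>
        (P.partition 1 le_rfl).1 (h ▸ hψ)
      obtain ⟨i, hi⟩ := hne
      exact ((P.partition 1 le_rfl).2 i).unique ⟨hψ, hi⟩ ⟨hu, Finset.mem_univ _⟩
    rw [Stilde, if_neg one_ne_zero, hsingle, Finset.sum_singleton]
  have hsmall : ∀ n, n < m →
      Stilde μ xm Q n = ∑ j : Fin m, Stilde μ x P ((n + (m - 1 - j)) / m) := by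
    intro n hn
    have hstage : ∀ j : Fin m, Stilde μ x P ((n + (m - 1 - j)) / m)
        = if (j : ℕ) < n then Hset μ x Finset.univ else 0 := by
      intro j
      have hj := j.2
      split_ifs with h
      · rw [Nat.div_eq_of_lt_le (k := 1) (by omega) (by omega), hP1]
      · rw [Nat.div_eq_of_lt (by omega), Stilde, if_pos rfl]
    have hcard : ∀ k, k ≤ m → (Finset.univ.filter fun j : Fin m => (j : ℕ) < k).card = k := by
      intro k hk
      simp [Fin.card_filter_val_lt, hk]
    rw [Finset.sum_congr rfl fun j _ => hstage j, ← Finset.sum_filter, Finset.sum_const,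
      hcard n hn.le]
    rcases Nat.eq_zero_or_pos n with rfl | hpos
    · simp [Stilde]
    obtain ⟨i⟩ := hι
    rw [Stilde, if_neg hpos.ne', hQsmall n hpos hn.le, Finset.sum_union, Finset.sum_image,
      Finset.sum_singleton, hH, hfst (fun k => n - 1 ≤ (k : ℕ)) ⟨n - 1, by omega⟩ le_rfl,
      Finset.sum_congr rfl fun j _ => (hH _).trans
        (congrArg _ (hfst (fun k => k = j) j rfl)),
      Finset.sum_const, hcard _ (by omega), ← succ_nsmul, Nat.sub_add_cancel hpos]
    · intro j _ j' _ h
      have hmem : (i, j) ∈ Finset.univ.filter fun p : ι × Fin m => p.2 = j := by simp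
      simp only at h
      rw [h] at hmem
      simpa using hmem
    · rw [Finset.disjoint_singleton_right, Finset.mem_image]
      rintro ⟨j, hj, h⟩
      have hmem : (i, j) ∈ Finset.univ.filter fun p : ι × Fin m => p.2 = j := by simp
      rw [h] at hmem
      simp only [Finset.mem_filter, Finset.mem_univ, true_and] at hj hmem
      omega
  have hall : ∀ n, Stilde μ xm Q n = ∑ j : Fin m, Stilde μ x P ((n + (m - 1 - j)) / m) :=
    fun n => (lt_or_ge n m).elim (hsmall n) (hlarge n)
  intro n hn
  obtain ⟨k, rfl⟩ : ∃ k, n = k + 1 := ⟨n - 1, by omega⟩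
  rw [C, C, Nat.add_sub_cancel, hall, hall, sum_stage_succ_sub _ hm,
    show k + 1 + m - 1 = k + m by omega, Nat.add_div_right _ hm,
    Nat.add_sub_cancel]
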